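/- For every n ∈ ℕ and also for n = ω, the σ-ideal σZ_n generated by the family of all Z_n-sets in the Hilbert cube I^ω is G_δ-generated. -/

import Mathlib

open Set Topology Cardinal

/-- The Hilbert cube `[0,1]^ℕ` with the product topology. -/
abbrev HilbertCube : Type := ℕ → ↥(Set.Icc (0:ℝ) 1)

/-- An ideal of subsets: a nonempty family closed under subsets and finite unions. -/
def IsIdeal {X : Type*} (I : Set (Set X)) : Prop :=
  I.Nonempty ∧ (∀ A ∈ I, ∀ B, B ⊆ A → B ∈ I) ∧ (∀ A ∈ I, ∀ B ∈ I, A ∪ B ∈ I)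

/-- A σ-ideal: an ideal closed under countable unions. -/
def IsSigmaIdeal {X : Type*} (I : Set (Set X)) : Prop :=
  IsIdeal I ∧ ∀ A : ℕ → Set X, (∀ n, A n ∈ I) → (⋃ n, A n) ∈ I

/-- A non-trivial ideal contains an uncountable set but not the whole space. -/
def NontrivialIdeal {X : Type*} (I : Set (Set X)) : Prop :=
  (∃ A ∈ I, ¬ A.Countable) ∧ Set.univ ∉ I

/-- An ideal on a topological space is topologically invariant if it is preserved by
all homeomorphisms of the space. -/
def TopInvariant {X : Type*} [TopologicalSpace X] (I : Set (Set X)) : Prop :=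
  ∀ h : X ≃ₜ X, {B | ∃ A ∈ I, B = h '' A} = I

/-- `I` has a base all of whose members satisfy `P`. -/
def HasBaseWith {X : Type*} (I : Set (Set X)) (P : Set X → Prop) : Prop :=
  ∃ B ⊆ I, (∀ A ∈ I, ∃ C ∈ B, A ⊆ C) ∧ ∀ C ∈ B, P C

/-- A set has the Baire property if it differs from some open set by a meager set. -/
def HasBaireProperty {X : Type*} [TopologicalSpace X] (A : Set X) : Prop :=
  ∃ U : Set X, IsOpen U ∧ IsMeagre ((A \ U) ∪ (U \ A))

/-- The σ-ideal of meager subsets of a topological space. -/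
def MeagerIdeal (X : Type*) [TopologicalSpace X] : Set (Set X) := {A | IsMeagre A}

/-- The σ-ideal generated by a family `F`: all subsets of countable unions of members
of `F`. -/
def sigmaGenerated {X : Type*} (F : Set (Set X)) : Set (Set X) :=
  {A | ∃ S : ℕ → Set X, (∀ n, S n ∈ F) ∧ A ⊆ ⋃ n, S n}

/-- A Cantor set in the Hilbert cube: a subset homeomorphic to the Cantor cube. -/
def IsCantorSet (C : Set HilbertCube) : Prop := Nonempty (C ≃ₜ (ℕ → Bool))

/-- A minimal Cantor set: one that can be mapped into any other Cantor set by an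
ambient homeomorphism. -/
def IsMinimalCantorSet (A : Set HilbertCube) : Prop :=
  IsCantorSet A ∧ ∀ B : Set HilbertCube, IsCantorSet B →
    ∃ h : HilbertCube ≃ₜ HilbertCube, h '' A ⊆ B

/-- The family of all minimal Cantor sets in the Hilbert cube. -/
def CantorFamily : Set (Set HilbertCube) := {A | IsMinimalCantorSet A}

/-- The σ-ideal generated by minimal Cantor sets. -/
def sigmaC0 : Set (Set HilbertCube) := sigmaGenerated CantorFamily

/-- A minimal dense Gδ-subset of the Hilbert cube. -/
def IsMinimalDenseGdelta (A : Set HilbertCube) : Prop :=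
  IsGδ A ∧ Dense A ∧ ∀ B : Set HilbertCube, IsGδ B → Dense B →
    ∃ h : HilbertCube ≃ₜ HilbertCube, h '' A ⊆ B

/-- The family of all minimal dense Gδ-sets in the Hilbert cube. -/
def GdeltaFamily : Set (Set HilbertCube) := {A | IsMinimalDenseGdelta A}

/-- The σ-ideal generated by minimal dense Gδ-sets. -/
def sigmaG0 : Set (Set HilbertCube) := sigmaGenerated GdeltaFamily

/-- `cov(I)`: the least cardinality of a subfamily of `I` covering the space. -/
noncomputable def covIdeal {X : Type*} (I : Set (Set X)) : Cardinal :=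
  sInf {c | ∃ A : Set (Set X), A ⊆ I ∧ ⋃₀ A = Set.univ ∧ c = #A}

/-- `non(I)`: the least cardinality of a subset of the space not in `I`. -/
noncomputable def nonIdeal {X : Type*} (I : Set (Set X)) : Cardinal :=
  sInf {c | ∃ A : Set X, A ∉ I ∧ c = #A}

/-- `add(I,J)`: the least cardinality of a subfamily of `I` whose union is not in `J`. -/
noncomputable def addIdeal2 {X : Type*} (I J : Set (Set X)) : Cardinal :=
  sInf {c | ∃ A : Set (Set X), A ⊆ I ∧ ⋃₀ A ∉ J ∧ c = #A}

/-- `add(I) = add(I,I)`. -/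
noncomputable def addIdeal {X : Type*} (I : Set (Set X)) : Cardinal := addIdeal2 I I

/-- `cof(I,J)`: the least cardinality of a subfamily of `J` cofinal in `I`. -/
noncomputable def cofIdeal2 {X : Type*} (I J : Set (Set X)) : Cardinal :=
  sInf {c | ∃ A : Set (Set X), A ⊆ J ∧ (∀ B ∈ I, ∃ C ∈ A, B ⊆ C) ∧ c = #A}

/-- `cof(I) = cof(I,I)`. -/
noncomputable def cofIdeal {X : Type*} (I : Set (Set X)) : Cardinal := cofIdeal2 I I

/-- The compact-open topology on the homeomorphism group of a space, induced by the
compact-open topology of the space of continuous self-maps. -/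
noncomputable instance homeoGroupTopology (X : Type*) [TopologicalSpace X] :
    TopologicalSpace (X ≃ₜ X) :=
  TopologicalSpace.induced (fun h : X ≃ₜ X => (⟨h, h.continuous⟩ : C(X, X)))
    ContinuousMap.compactOpen

/-- A Z-set: a closed set `A` such that for every open cover `U` of the space there is a
continuous map into the complement of `A` which is `U`-near to the identity. -/
def IsZSet {X : Type*} [TopologicalSpace X] (A : Set X) : Prop :=
  IsClosed A ∧ ∀ U : Set (Set X), (∀ V ∈ U, IsOpen V) → ⋃₀ U = Set.univ →
    ∃ f : C(X, X), (∀ x, f x ∉ A) ∧ ∀ x : X, ∃ V ∈ U, x ∈ V ∧ f x ∈ V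

/-- A σZ-set: a countable union of Z-sets. -/
def IsSigmaZSet {X : Type*} [TopologicalSpace X] (A : Set X) : Prop :=
  ∃ Z : ℕ → Set X, (∀ n, IsZSet (Z n)) ∧ A = ⋃ n, Z n

/-- The cube `[0,1]^n`. -/
abbrev FinCube (n : ℕ) : Type := Fin n → ↥(Set.Icc (0:ℝ) 1)

/-- A `Z_n`-set in the Hilbert cube: a closed set `A` such that maps avoiding `A` are
dense in the space `C([0,1]^n, I^ω)` with the compact-open topology. -/
def IsZnSet (n : ℕ) (A : Set HilbertCube) : Prop :=
  IsClosed A ∧ Dense {f : C(FinCube n, HilbertCube) | ∀ x, f x ∉ A}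

/-- A `Z_ω`-set in the Hilbert cube: a closed set which is a `Z_n`-set for all `n`. -/
def IsZomegaSet (A : Set HilbertCube) : Prop :=
  IsClosed A ∧ ∀ n : ℕ, IsZnSet n A

/-- Covering dimension of a space is at most `n`: every finite open cover has a finite
open refinement (still a cover) in which no point belongs to more than `n+1` members. -/
def CovDimLE (Y : Type*) [TopologicalSpace Y] (n : ℕ) : Prop :=
  ∀ U : Set (Set Y), U.Finite → (∀ V ∈ U, IsOpen V) → ⋃₀ U = Set.univ →
    ∃ V : Set (Set Y), V.Finite ∧ (∀ W ∈ V, IsOpen W) ∧ ⋃₀ V = Set.univ ∧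
      (∀ W ∈ V, ∃ W' ∈ U, W ⊆ W') ∧
      ∀ y : Y, {W ∈ V | y ∈ W}.ncard ≤ n + 1

/-- A `G_δ`-generated topologically invariant ideal on the Hilbert cube. -/
def GdeltaGenerated (I : Set (Set HilbertCube)) : Prop :=
  HasBaseWith I IsSigmaCompact ∧
  ∃ G : Set HilbertCube, IsGδ G ∧
    (∀ K : Set HilbertCube, K ⊆ G → IsCompact K → K ∈ I) ∧
    ∀ A ∈ I, IsCompact A →
      Dense {h : HilbertCube ≃ₜ HilbertCube | h '' A ⊆ G}

/-- A `G_δ*`-generated ideal: a preimage of a `G_δ`-generated ideal under an embedding. -/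
def GdeltaStarGenerated (I : Set (Set HilbertCube)) : Prop :=
  ∃ I' : Set (Set HilbertCube), GdeltaGenerated I' ∧
    ∃ e : HilbertCube → HilbertCube, IsEmbedding e ∧ I = {S | ∃ A ∈ I', S = e ⁻¹' A}

/-- A `σG_δ*`-generated ideal. -/
def SigmaGdeltaStarGenerated (I : Set (Set HilbertCube)) : Prop :=
  ∃ In : ℕ → Set (Set HilbertCube), (∀ n, GdeltaStarGenerated (In n)) ∧
    (∀ n, In n ⊆ I) ∧
    ∀ A ∈ I, ∃ K : ℕ → Set HilbertCube,
      (∀ n, IsCompact (K n) ∧ K n ∈ In n) ∧ A ⊆ ⋃ n, K n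


lemma HilbertCube.exists_coord_mem_of_mem_nhds {X : Type*} [TopologicalSpace X] [CompactSpace X]
    (f : C(X, HilbertCube)) {U : Set C(X, HilbertCube)} (hU : U ∈ 𝓝 f) :
    ∃ L : ℕ, ∀ g : C(X, HilbertCube),
      (∀ x, ∀ j < L, |(g x j : ℝ) - f x j| < 1 / ((L : ℝ) + 1)) → g ∈ U := by
  by_contra! h
  choose g hg hgU using h
  have hlim : Filter.Tendsto g Filter.atTop (𝓝 f) := by
    rw [ContinuousMap.tendsto_iff_tendstoUniformly, tendstoUniformly_iff_tendsto, Pi.uniformity,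
      Filter.tendsto_iInf]
    intro j
    rw [Filter.tendsto_comap_iff]
    refine tendstoUniformly_iff_tendsto (F := fun L x => g L x j) (f := fun x => f x j) |>.1 ?_
    rw [Metric.tendstoUniformly_iff]
    intro ε hε
    obtain ⟨N, hN⟩ := exists_nat_one_div_lt hε
    filter_upwards [Filter.eventually_gt_atTop (max j N)] with L hL x
    have h1 := hg L x j (by omega)
    rw [Subtype.dist_eq, Real.dist_eq, abs_sub_comm]
    refine h1.trans (lt_trans ?_ hN)
    apply one_div_lt_one_div_of_lt (by positivity)
    have : (N : ℝ) < L := by exact_mod_cast (le_max_right j N).trans_lt hL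
    linarith
  obtain ⟨L, hL⟩ := (hlim.eventually hU).exists
  exact hgU L hL

lemma ContinuousMap.isOpen_setOf_graph_mem {X Y : Type*} [TopologicalSpace X] [CompactSpace X]
    [LocallyCompactSpace X]
    [TopologicalSpace Y] {W : Set (X × Y)} (hW : IsOpen W) :
    IsOpen {g : C(X, Y) | ∀ x, (x, g x) ∈ W} := by
  have h : Continuous fun g : C(X, Y) => (ContinuousMap.id X).prodMk g := by
    refine ContinuousMap.continuous_of_continuous_uncurry _ ?_
    simp only [Function.uncurry_def]
    exact continuous_snd.prodMk continuous_eval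
  have := (ContinuousMap.isOpen_setOfPred_mapsTo (X := X) isCompact_univ hW).preimage h
  simpa [MapsTo] using! this

lemma ContinuousMap.isOpen_setOf_forall_notMem {X Y : Type*} [TopologicalSpace X] [CompactSpace X]
    [TopologicalSpace Y] {A : Set Y} (hA : IsClosed A) :
    IsOpen {g : C(X, Y) | ∀ x, g x ∉ A} := by
  simpa [MapsTo] using! ContinuousMap.isOpen_setOfPred_mapsTo (X := X) isCompact_univ hA.isOpen_compl

section HomeoGroup

variable {X : Type*} [TopologicalSpace X]

lemma Homeomorph.continuous_toContinuousMap_compactOpen :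
    Continuous fun h : X ≃ₜ X => (⟨h, h.continuous⟩ : C(X, X)) :=
  continuous_induced_dom

lemma Homeomorph.isOpen_setOf_mapsTo {K U : Set X} (hK : IsCompact K) (hU : IsOpen U) :
    IsOpen {h : X ≃ₜ X | MapsTo h K U} :=
  (ContinuousMap.isOpen_setOfPred_mapsTo hK hU).preimage
    Homeomorph.continuous_toContinuousMap_compactOpen

lemma Homeomorph.continuous_symm_compactOpen [CompactSpace X] [T2Space X] :
    Continuous fun h : X ≃ₜ X => (⟨h.symm, h.symm.continuous⟩ : C(X, X)) := by
  rw [ContinuousMap.continuous_compactOpen]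
  intro K hK U hU
  convert Homeomorph.isOpen_setOf_mapsTo (X := X) hU.isClosed_compl.isCompact
    hK.isClosed.isOpen_compl using 1
  ext h
  constructor
  · intro H x hx hxK
    exact hx (by simpa using H hxK)
  · intro H x hx
    by_contra hxU
    exact H hxU (by simpa using hx)

lemma Homeomorph.continuous_trans_left (h₀ : X ≃ₜ X) : Continuous fun k : X ≃ₜ X => h₀.trans k := by
  rw [continuous_induced_rng]
  exact (ContinuousMap.continuous_precomp (⟨h₀, h₀.continuous⟩ : C(X, X))).comp
    Homeomorph.continuous_toContinuousMap_compactOpen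

lemma Homeomorph.isClosedEmbedding_pair [CompactSpace X] [T2Space X] :
    IsClosedEmbedding fun h : X ≃ₜ X =>
      ((⟨h, h.continuous⟩ : C(X, X)), (⟨h.symm, h.symm.continuous⟩ : C(X, X))) := by
  refine ⟨⟨⟨le_antisymm ?_ ?_⟩, ?_⟩, ?_⟩
  · exact (Homeomorph.continuous_toContinuousMap_compactOpen.prodMk
      Homeomorph.continuous_symm_compactOpen).le_induced
  · change _ ≤ TopologicalSpace.induced _ _
    rw [show (fun h : X ≃ₜ X => (⟨h, h.continuous⟩ : C(X, X))) = Prod.fst ∘ fun h : X ≃ₜ X =>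
      ((⟨h, h.continuous⟩ : C(X, X)), (⟨h.symm, h.symm.continuous⟩ : C(X, X))) from rfl,
      ← induced_compose]
    exact induced_mono continuous_fst.le_induced
  · intro h k hk
    ext x
    exact DFunLike.congr_fun (congrArg Prod.fst hk) x
  · have : range (fun h : X ≃ₜ X =>
        ((⟨h, h.continuous⟩ : C(X, X)), (⟨h.symm, h.symm.continuous⟩ : C(X, X)))) =
        {p : C(X, X) × C(X, X) | p.1.comp p.2 = .id X} ∩
        {p : C(X, X) × C(X, X) | p.2.comp p.1 = .id X} := by
      ext ⟨f, g⟩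
      constructor
      · rintro ⟨h, hh⟩
        obtain ⟨rfl, rfl⟩ := Prod.mk.inj hh
        constructor <;> ext x <;> simp
      · rintro ⟨h1, h2⟩
        exact ⟨⟨⟨f, g, fun x => DFunLike.congr_fun h2 x, fun x => DFunLike.congr_fun h1 x⟩,
          f.continuous, g.continuous⟩, rfl⟩
    rw [this]
    exact (isClosed_eq (continuous_fst.compCM continuous_snd) continuous_const).inter
      (isClosed_eq (ContinuousMap.continuous_comp'.comp continuous_id) continuous_const)

end HomeoGroup

namespace HilbertCube

instance polishSpace_continuousMap {X : Type*} [TopologicalSpace X] [CompactSpace X]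
    [LocallyCompactSpace X] [SecondCountableTopology X] : PolishSpace C(X, HilbertCube) := by
  let := UniformSpace.metricSpace C(X, HilbertCube)
  infer_instance

instance polishSpace_homeomorph : PolishSpace (HilbertCube ≃ₜ HilbertCube) :=
  Homeomorph.isClosedEmbedding_pair.polishSpace

lemma mobius_denom_pos (s : ℝ) (t : ↥(Set.Icc (0:ℝ) 1)) :
    0 < 1 - (t : ℝ) + Real.exp s * t := by
  obtain ⟨t, h0, h1⟩ := t
  have := Real.exp_pos s
  rcases h0.eq_or_lt with rfl | h
  · simp
  · have := mul_pos this h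
    simp only
    linarith

/-- The flow on `[0,1]` that adds `s` to the logit `log (t / (1 - t))`. -/
noncomputable def mobius (s : ℝ) (t : ↥(Set.Icc (0:ℝ) 1)) : ↥(Set.Icc (0:ℝ) 1) :=
  ⟨Real.exp s * t / (1 - t + Real.exp s * t), by
    have h := mobius_denom_pos s t
    have h' := mul_nonneg (Real.exp_pos s).le t.2.1
    refine ⟨div_nonneg h' h.le, ?_⟩
    rw [div_le_one h]
    linarith [t.2.2]⟩

lemma continuous_mobius : Continuous fun p : ℝ × ↥(Set.Icc (0:ℝ) 1) => mobius p.1 p.2 := by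
  refine Continuous.subtype_mk ?_ _
  refine Continuous.div (by fun_prop) (by fun_prop) fun p => (mobius_denom_pos _ _).ne'

lemma mobius_mobius (s r : ℝ) (t : ↥(Set.Icc (0:ℝ) 1)) :
    mobius s (mobius r t) = mobius (s + r) t := by
  have h := (mobius_denom_pos r t).ne'
  have h' := (mobius_denom_pos (s + r) t).ne'
  ext
  simp only [mobius, Real.exp_add] at *
  have key : 1 - Real.exp r * (t : ℝ) / (1 - t + Real.exp r * t) +
      Real.exp s * (Real.exp r * t / (1 - t + Real.exp r * t)) =
      (1 - t + Real.exp s * Real.exp r * t) / (1 - t + Real.exp r * t) := by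
    field_simp
    ring
  rw [key]
  field_simp

@[simp]
lemma mobius_zero (t : ↥(Set.Icc (0:ℝ) 1)) : mobius 0 t = t := by
  ext
  simp [mobius]

lemma abs_mobius_sub_le (s : ℝ) (t : ↥(Set.Icc (0:ℝ) 1)) :
    |(mobius s t : ℝ) - t| ≤ |Real.exp s - 1| := by
  have h := mobius_denom_pos s t
  have h' := mul_nonneg (Real.exp_pos s).le t.2.1
  have ht := t.2.1
  have ht' := t.2.2
  have key : (mobius s t : ℝ) - t =
      (Real.exp s - 1) * (t * (1 - t) / (1 - t + Real.exp s * t)) := by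
    simp only [mobius]
    field_simp
    ring
  rw [key, abs_mul]
  refine mul_le_of_le_one_right (abs_nonneg _) ?_
  rw [abs_of_nonneg (div_nonneg (mul_nonneg ht (by linarith)) h.le), div_le_one h]
  nlinarith

/-- The logistic function with values in the unit interval. -/
noncomputable def logistic (s : ℝ) : ↥(Set.Icc (0:ℝ) 1) :=
  mobius s ⟨1 / 2, by norm_num, by norm_num⟩

lemma coe_logistic (s : ℝ) : (logistic s : ℝ) = Real.exp s / (1 + Real.exp s) := by
  have := Real.exp_pos s
  simp only [logistic, mobius]
  field_simp
  ring

lemma mobius_logistic (s r : ℝ) : mobius s (logistic r) = logistic (s + r) :=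
  mobius_mobius _ _ _

lemma continuous_logistic : Continuous logistic :=
  continuous_mobius.comp (continuous_id.prodMk continuous_const)

lemma strictMono_logistic : StrictMono logistic := by
  intro s r h
  have hs := Real.exp_pos s
  have hr := Real.exp_pos r
  have := Real.exp_lt_exp.2 h
  rw [← Subtype.coe_lt_coe, coe_logistic, coe_logistic, div_lt_div_iff₀ (by positivity)
    (by positivity)]
  nlinarith

/-- A continuous approximate logit: the logit of `(t + δ) / (1 + 2 * δ)`. -/
noncomputable def approxLogit (δ : ℝ) (t : ↥(Set.Icc (0:ℝ) 1)) : ℝ :=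
  Real.log ((t + δ) / (1 - t + δ))

lemma continuous_approxLogit {δ : ℝ} (hδ : 0 < δ) : Continuous (approxLogit δ) := by
  have h (t : ↥(Set.Icc (0:ℝ) 1)) : 0 < (t : ℝ) + δ := by linarith [t.2.1]
  have h' (t : ↥(Set.Icc (0:ℝ) 1)) : 0 < 1 - (t : ℝ) + δ := by linarith [t.2.2]
  refine Continuous.log (Continuous.div (by fun_prop) (by fun_prop) fun t => (h' t).ne') ?_
  exact fun t => (div_pos (h t) (h' t)).ne'

lemma logistic_approxLogit {δ : ℝ} (hδ : 0 < δ) (t : ↥(Set.Icc (0:ℝ) 1)) :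
    (logistic (approxLogit δ t) : ℝ) = (t + δ) / (1 + 2 * δ) := by
  have h : 0 < (t : ℝ) + δ := by linarith [t.2.1]
  have h' : 0 < 1 - (t : ℝ) + δ := by linarith [t.2.2]
  rw [coe_logistic, approxLogit, Real.exp_log (div_pos h h')]
  field_simp
  ring

lemma abs_logistic_approxLogit_sub_le {δ : ℝ} (hδ : 0 < δ) (t : ↥(Set.Icc (0:ℝ) 1)) :
    |(logistic (approxLogit δ t) : ℝ) - t| ≤ δ := by
  have := t.2.1
  have := t.2.2
  rw [logistic_approxLogit hδ, abs_le]
  have h : ((t : ℝ) + δ) / (1 + 2 * δ) - t = δ * (1 - 2 * t) / (1 + 2 * δ) := by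
    field_simp
    ring
  rw [h, le_div_iff₀ (by positivity), div_le_iff₀ (by positivity)]
  constructor <;> nlinarith [mul_pos hδ hδ]

variable {n : ℕ}

/-- The logits of a map `[0,1]^n → [0,1]^ℕ` given by `q` in the first `N` coordinates, by an
embedding of `[0,1]^n` in the next `n` coordinates, and constant in the others. -/
noncomputable def curveLogit (N : ℕ) (q : C(FinCube n, ℕ → ℝ)) (x : FinCube n) (j : ℕ) : ℝ :=
  if j < N then q x j else if h : j - N < n then approxLogit 1 (x ⟨j - N, h⟩) else 0

lemma continuous_curveLogit (N : ℕ) (q : C(FinCube n, ℕ → ℝ)) (j : ℕ) :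
    Continuous fun x => curveLogit N q x j := by
  unfold curveLogit
  split_ifs
  · fun_prop
  · exact (continuous_approxLogit one_pos).comp (continuous_apply _)
  · exact continuous_const

/-- The map `[0,1]^n → [0,1]^ℕ` with logits `curveLogit N q`. -/
noncomputable def curve (N : ℕ) (q : C(FinCube n, ℕ → ℝ)) : C(FinCube n, HilbertCube) where
  toFun x j := logistic (curveLogit N q x j)
  continuous_toFun := continuous_pi fun j => continuous_logistic.comp (continuous_curveLogit N q j)

lemma curve_apply (N : ℕ) (q : C(FinCube n, ℕ → ℝ)) (x : FinCube n) (j : ℕ) :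
    curve N q x j = logistic (curveLogit N q x j) := rfl

/-- A retraction of the Hilbert cube recovering `x` from coordinates `N, …, N + n - 1` of
`curve N q x`. -/
noncomputable def reader (n N : ℕ) (y : HilbertCube) : FinCube n :=
  fun i => Set.projIcc 0 1 zero_le_one (3 * (y (N + i) : ℝ) - 1)

lemma continuous_reader (N : ℕ) : Continuous (reader n N) :=
  continuous_pi fun i => continuous_projIcc.comp (by fun_prop)

lemma reader_congr {N : ℕ} {y z : HilbertCube} (h : ∀ i < n, y (N + i) = z (N + i)) :
    reader n N y = reader n N z := by
  ext i
  simp [reader, h i i.2]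

lemma reader_curve (N : ℕ) (q : C(FinCube n, ℕ → ℝ)) (x : FinCube n) :
    reader n N (curve N q x) = x := by
  ext i
  have h : (3 * (curve N q x (N + i) : ℝ) - 1) = x i := by
    simp only [curve_apply, curveLogit, add_lt_iff_neg_left, not_lt_zero, if_false,
      add_tsub_cancel_left, i.2, dif_pos]
    rw [logistic_approxLogit one_pos]
    ring
  simp only [reader, h, Set.projIcc_val]

open Classical in
/-- Move the coordinates in `J` along the flow `mobius` with speed depending on the coordinates
`K, …, K + n - 1`. -/
noncomputable def shearFun (Δ : FinCube n → ℕ → ℝ) (K : ℕ) (J : Set ℕ) (y : HilbertCube) :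
    HilbertCube :=
  fun j => if j ∈ J then mobius (Δ (reader n K y) j) (y j) else y j

lemma shearFun_of_mem {Δ : FinCube n → ℕ → ℝ} {K : ℕ} {J : Set ℕ} {j : ℕ} (hj : j ∈ J)
    (y : HilbertCube) : shearFun Δ K J y j = mobius (Δ (reader n K y) j) (y j) := if_pos hj

lemma shearFun_of_notMem {Δ : FinCube n → ℕ → ℝ} {K : ℕ} {J : Set ℕ} {j : ℕ} (hj : j ∉ J)
    (y : HilbertCube) : shearFun Δ K J y j = y j := if_neg hj

lemma continuous_shearFun {Δ : FinCube n → ℕ → ℝ} (hΔ : ∀ j, Continuous fun x => Δ x j) (K : ℕ)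
    (J : Set ℕ) : Continuous (shearFun Δ K J) := by
  refine continuous_pi fun j => ?_
  by_cases hj : j ∈ J
  · simp only [shearFun_of_mem hj]
    exact continuous_mobius.comp
      (((hΔ j).comp (continuous_reader K)).prodMk (continuous_apply j))
  · simp only [shearFun_of_notMem hj]
    exact continuous_apply j

lemma shearFun_neg_shearFun (Δ : FinCube n → ℕ → ℝ) {K : ℕ} {J : Set ℕ}
    (hJ : ∀ i < n, K + i ∉ J) (y : HilbertCube) :
    shearFun (-Δ) K J (shearFun Δ K J y) = y := by
  have hr : reader n K (shearFun Δ K J y) = reader n K y :=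
    reader_congr fun i hi => shearFun_of_notMem (hJ i hi) y
  funext j
  by_cases hj : j ∈ J
  · rw [shearFun_of_mem hj, shearFun_of_mem hj, hr, mobius_mobius]
    simp
  · rw [shearFun_of_notMem hj, shearFun_of_notMem hj]

/-- `shearFun` as a homeomorphism. -/
noncomputable def shear (Δ : FinCube n → ℕ → ℝ) (hΔ : ∀ j, Continuous fun x => Δ x j) (K : ℕ)
    (J : Set ℕ) (hJ : ∀ i < n, K + i ∉ J) : HilbertCube ≃ₜ HilbertCube where
  toFun := shearFun Δ K J
  invFun := shearFun (-Δ) K J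
  left_inv := shearFun_neg_shearFun Δ hJ
  right_inv y := by simpa using shearFun_neg_shearFun (-Δ) hJ y
  continuous_toFun := continuous_shearFun hΔ K J
  continuous_invFun := continuous_shearFun (fun j => (hΔ j).neg) K J

/-- Curves with the same source, the second one parametrized farther away, are matched by a
homeomorphism moving the first coordinates no more than the curves differ. -/
lemma exists_homeomorph_curve {N M : ℕ} (hNM : N + n ≤ M) (q p : C(FinCube n, ℕ → ℝ)) :
    ∃ h : HilbertCube ≃ₜ HilbertCube, (∀ x, h (curve M p x) = curve N q x) ∧
      ∀ y, ∀ j < M, ∃ x,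
        h y j = mobius (curveLogit N q x j - curveLogit M p x j) (y j) := by
  set Δ : FinCube n → ℕ → ℝ := fun x j => curveLogit N q x j - curveLogit M p x j with hΔ
  have hc : ∀ j, Continuous fun x => Δ x j := fun j =>
    (continuous_curveLogit N q j).sub (continuous_curveLogit M p j)
  have hJ₂ : ∀ i < n, M + i ∉ Set.Iio M := fun i _ h => by simp at h
  have hJ₁ : ∀ i < n, N + i ∉ Set.Ico M (M + n) := fun i _ h => by
    have := h.1
    omega
  refine ⟨(shear Δ hc M (Set.Iio M) hJ₂).trans (shear Δ hc N (Set.Ico M (M + n)) hJ₁), ?_, ?_⟩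
  · intro x
    set z := shearFun Δ M (Set.Iio M) (curve M p x) with hz
    have hzlt : ∀ j < M, z j = curve N q x j := fun j hj => by
      rw [hz, shearFun_of_mem (Set.mem_Iio.2 hj), reader_curve, curve_apply, mobius_logistic,
        curve_apply]
      simp [hΔ]
    have hzge : ∀ j, M ≤ j → z j = curve M p x j := fun j hj => by
      rw [hz, shearFun_of_notMem (by simpa using hj)]
    have hr : reader n N z = x := by
      conv_rhs => rw [← reader_curve N q x]
      exact reader_congr fun i hi => hzlt _ (by omega)
    change shearFun Δ N (Set.Ico M (M + n)) z = _
    funext j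
    by_cases hj : j ∈ Set.Ico M (M + n)
    · rw [shearFun_of_mem hj, hr, hzge j hj.1, curve_apply, mobius_logistic, curve_apply]
      simp [hΔ]
    · rw [shearFun_of_notMem hj]
      rcases lt_or_ge j M with h | h
      · exact hzlt j h
      · have h' : M + n ≤ j := by
          by_contra h''
          exact hj ⟨h, by omega⟩
        rw [hzge j h, curve_apply, curve_apply]
        congr 1
        rw [curveLogit, curveLogit, if_neg (by omega), dif_neg (by omega), if_neg (by omega),
          dif_neg (by omega)]
  · intro y j hj
    refine ⟨reader n M y, ?_⟩
    change shearFun Δ N (Set.Ico M (M + n)) (shearFun Δ M (Set.Iio M) y) j = _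
    rw [shearFun_of_notMem (by simp [hj]), shearFun_of_mem (Set.mem_Iio.2 hj)]

/-- Every nonempty open set of maps contains a `curve` with large parameter from a dense set. -/
lemma exists_curve_mem {D : Set C(FinCube n, ℕ → ℝ)} (hD : Dense D)
    {U : Set C(FinCube n, HilbertCube)} (hU : IsOpen U) (hne : U.Nonempty) (N₀ : ℕ) :
    ∃ N ≥ N₀, ∃ q ∈ D, curve N q ∈ U := by
  obtain ⟨f, hf⟩ := hne
  obtain ⟨L, hL⟩ := exists_coord_mem_of_mem_nhds f (hU.mem_nhds hf)
  have hL0 : (0 : ℝ) < 1 / ((L : ℝ) + 1) := by positivity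
  set W : Set (FinCube n × (ℕ → ℝ)) := ⋂ j ∈ Finset.range L,
    {p | |(logistic (p.2 j) : ℝ) - f p.1 j| < 1 / ((L : ℝ) + 1)} with hW
  have hWo : IsOpen W := by
    refine isOpen_biInter_finset fun j _ => isOpen_lt ?_ continuous_const
    have h1 : Continuous fun p : FinCube n × (ℕ → ℝ) => logistic (p.2 j) :=
      continuous_logistic.comp (by fun_prop)
    have h2 : Continuous fun p : FinCube n × (ℕ → ℝ) => f p.1 j := by fun_prop
    exact ((continuous_subtype_val.comp h1).sub (continuous_subtype_val.comp h2)).abs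
  obtain ⟨q, hqW, hqD⟩ := hD.inter_open_nonempty _
    (ContinuousMap.isOpen_setOf_graph_mem hWo)
    ⟨⟨fun x j => approxLogit (1 / ((L : ℝ) + 1) / 2) (f x j), continuous_pi fun j =>
      (continuous_approxLogit (by positivity)).comp (by fun_prop)⟩, fun x => by
        simp only [hW, Set.mem_iInter]
        intro j _
        exact (abs_logistic_approxLogit_sub_le (by positivity) _).trans_lt (half_lt_self hL0)⟩
  refine ⟨max N₀ L, le_max_left _ _, q, hqD, hL _ fun x j hj => ?_⟩
  have := hqW x
  simp only [hW, Set.mem_iInter, Finset.mem_range] at this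
  rw [curve_apply, curveLogit, if_pos (lt_max_of_lt_right hj)]
  exact this j hj

/-- A `Z_n`-set can be pushed off a `curve` by homeomorphisms close to the identity. -/
lemma exists_homeomorph_avoiding_curve {A : Set HilbertCube} (hA : IsZnSet n A) (N : ℕ)
    (q : C(FinCube n, ℕ → ℝ)) (L : ℕ) {ε : ℝ} (hε : 0 < ε) :
    ∃ h : HilbertCube ≃ₜ HilbertCube, (∀ a ∈ A, h a ∉ Set.range (curve N q)) ∧
      ∀ y, ∀ j < L, |(h y j : ℝ) - y j| < ε := by
  obtain ⟨η, hη, hexp⟩ := Metric.continuous_iff.1 Real.continuous_exp 0 ε hε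
  set W : Set (FinCube n × HilbertCube) := ⋂ j ∈ Finset.range L,
    {p | p.2 j ∈ Set.Ioo (logistic (curveLogit N q p.1 j - η))
      (logistic (curveLogit N q p.1 j + η))} with hW
  have hWo : IsOpen W := by
    refine isOpen_biInter_finset fun j _ => ?_
    have h0 : Continuous fun p : FinCube n × HilbertCube => curveLogit N q p.1 j :=
      (continuous_curveLogit N q j).comp continuous_fst
    have h2 : Continuous fun p : FinCube n × HilbertCube => p.2 j :=
      (continuous_apply j).comp continuous_snd
    have h3 : IsOpen {p : FinCube n × HilbertCube | p.2 j < logistic (curveLogit N q p.1 j + η)} :=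
      isOpen_lt h2 (continuous_logistic.comp (h0.add continuous_const))
    exact (isOpen_lt (continuous_logistic.comp (h0.sub continuous_const)) h2).inter h3
  have hne := hA.2.inter_open_nonempty _ (ContinuousMap.isOpen_setOf_graph_mem hWo)
    ⟨curve N q, fun x => by
      simp only [hW, Set.mem_iInter]
      exact fun j _ => ⟨strictMono_logistic (by linarith), strictMono_logistic (by linarith)⟩⟩
  obtain ⟨M, hM, p, -, hpW, hpA⟩ := exists_curve_mem dense_univ
    ((ContinuousMap.isOpen_setOf_graph_mem hWo).inter
      (ContinuousMap.isOpen_setOf_forall_notMem hA.1)) hne (max (N + n) L)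
  obtain ⟨h, hh, hmove⟩ := exists_homeomorph_curve ((le_max_left _ _).trans hM) q p
  refine ⟨h, ?_, fun y j hj => ?_⟩
  · rintro a ha ⟨x, hx⟩
    rw [← hh] at hx
    exact hpA x (h.injective hx ▸ ha)
  · obtain ⟨x, hx⟩ := hmove y j (hj.trans_le ((le_max_right _ _).trans hM))
    rw [hx]
    refine (abs_mobius_sub_le _ _).trans_lt ?_
    have h1 := hpW x
    simp only [hW, Set.mem_iInter, Finset.mem_range] at h1
    obtain ⟨h2, h3⟩ := h1 j hj
    have h2 := strictMono_logistic.lt_iff_lt.1 h2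
    have h3 := strictMono_logistic.lt_iff_lt.1 h3
    have := hexp (curveLogit N q x j - curveLogit M p x j) (by
      rw [Real.dist_eq, abs_lt]
      constructor <;> linarith)
    rwa [Real.dist_eq, Real.exp_zero] at this

end HilbertCube

lemma IsZnSet.image {n : ℕ} {A : Set HilbertCube} (hA : IsZnSet n A)
    (h : HilbertCube ≃ₜ HilbertCube) : IsZnSet n (h '' A) := by
  refine ⟨h.isClosedMap _ hA.1, ?_⟩
  have hsurj : Function.Surjective
      (ContinuousMap.comp (⟨h, h.continuous⟩ : C(HilbertCube, HilbertCube)) :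
        C(FinCube n, HilbertCube) → C(FinCube n, HilbertCube)) := fun g =>
    ⟨ContinuousMap.comp ⟨h.symm, h.symm.continuous⟩ g, by ext; simp⟩
  refine (hsurj.denseRange.dense_image (ContinuousMap.continuous_postcomp _) hA.2).mono ?_
  rintro _ ⟨f, hf, rfl⟩ x ⟨a, ha, hax⟩
  exact hf x (h.injective hax ▸ ha)

lemma IsZnSet.of_subset_iUnion {n : ℕ} {A : Set HilbertCube} (hA : IsClosed A)
    {S : ℕ → Set HilbertCube} (hS : ∀ k, IsZnSet n (S k)) (hAS : A ⊆ ⋃ k, S k) :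
    IsZnSet n A := by
  refine ⟨hA, (dense_iInter_of_isOpen (fun k =>
    ContinuousMap.isOpen_setOf_forall_notMem (hS k).1) fun k => (hS k).2).mono ?_⟩
  intro f hf x hx
  obtain ⟨k, hk⟩ := Set.mem_iUnion.1 (hAS hx)
  exact Set.mem_iInter.1 hf k x hk

namespace HilbertCube

lemma dense_homeomorph_avoiding_curve {n : ℕ} {A : Set HilbertCube} (hA : IsZnSet n A) (N : ℕ)
    (q : C(FinCube n, ℕ → ℝ)) :
    Dense {h : HilbertCube ≃ₜ HilbertCube | MapsTo h A (Set.range (curve N q))ᶜ} := by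
  rw [dense_iff_inter_open]
  rintro W hW ⟨h₀, hh₀⟩
  have hV := (hW.preimage (Homeomorph.continuous_trans_left h₀)).mem_nhds
    (x := Homeomorph.refl _) (by simpa using! hh₀)
  rw [nhds_induced] at hV
  obtain ⟨U, hU, hUV⟩ := hV
  obtain ⟨L, hL⟩ := exists_coord_mem_of_mem_nhds _ hU
  obtain ⟨k, hk, hkL⟩ := exists_homeomorph_avoiding_curve (hA.image h₀) N q L
    (ε := 1 / ((L : ℝ) + 1)) (by positivity)
  exact ⟨h₀.trans k, hUV (hL ⟨k, k.continuous⟩ hkL), fun a ha => hk _ (Set.mem_image_of_mem _ ha)⟩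

end HilbertCube

lemma gdeltaGenerated_sigmaGenerated_isZnSet (T : Set ℕ) :
    GdeltaGenerated (sigmaGenerated {A | IsClosed A ∧ ∀ n ∈ T, IsZnSet n A}) := by
  refine ⟨⟨{C | ∃ S : ℕ → Set HilbertCube, (∀ k, IsClosed (S k) ∧ ∀ n ∈ T, IsZnSet n (S k)) ∧
    C = ⋃ k, S k}, ?_, ?_, ?_⟩, ?_⟩
  · rintro _ ⟨S, hS, rfl⟩
    exact ⟨S, hS, Subset.rfl⟩
  · rintro A ⟨S, hS, hAS⟩
    exact ⟨_, ⟨S, hS, rfl⟩, hAS⟩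
  · rintro _ ⟨S, hS, rfl⟩
    exact isSigmaCompact_iUnion_of_isCompact S fun k => (hS k).1.isCompact
  have hclosed (n N : ℕ) (q : C(FinCube n, ℕ → ℝ)) :
      IsClosed (Set.range (HilbertCube.curve N q)) :=
    (isCompact_range (HilbertCube.curve N q).continuous).isClosed
  refine ⟨⋂ i : T × ℕ × ℕ, (Set.range (HilbertCube.curve (n := i.1) i.2.1
    (TopologicalSpace.denseSeq C(FinCube i.1, ℕ → ℝ) i.2.2)))ᶜ,
    IsGδ.iInter fun i => (hclosed _ _ _).isOpen_compl.isGδ, ?_, ?_⟩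
  · intro K hKG hK
    refine ⟨fun _ => K, fun _ => ⟨hK.isClosed, fun n hn => ⟨hK.isClosed, ?_⟩⟩,
      subset_iUnion (fun _ => K) 0⟩
    rw [dense_iff_inter_open]
    intro U hU hne
    obtain ⟨N, -, q, ⟨k, rfl⟩, hq⟩ := HilbertCube.exists_curve_mem
      (TopologicalSpace.denseRange_denseSeq C(FinCube n, ℕ → ℝ)) hU hne 0
    exact ⟨_, hq, fun x hx => Set.mem_iInter.1 (hKG hx) (⟨n, hn⟩, N, k) ⟨x, rfl⟩⟩
  · rintro A ⟨S, hS, hAS⟩ hA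
    have hZ : ∀ n ∈ T, IsZnSet n A := fun n hn =>
      .of_subset_iUnion hA.isClosed (fun k => (hS k).2 n hn) hAS
    refine (dense_iInter_of_isOpen (fun i : T × ℕ × ℕ =>
      Homeomorph.isOpen_setOf_mapsTo hA (hclosed _ _ _).isOpen_compl) fun i =>
        HilbertCube.dense_homeomorph_avoiding_curve (hZ i.1 i.1.2) i.2.1
          (TopologicalSpace.denseSeq C(FinCube i.1, ℕ → ℝ) i.2.2)).mono ?_
    rintro h hh _ ⟨a, ha, rfl⟩
    exact Set.mem_iInter.2 fun i => Set.mem_iInter.1 hh i ha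

/-- For every `n ∈ ℕ` and for `n = ω`, the σ-ideal `σZ_n` generated by all `Z_n`-sets
in the Hilbert cube is `G_δ`-generated. -/
theorem sigmaZn_GdeltaGenerated :
    (∀ n : ℕ, GdeltaGenerated (sigmaGenerated {A | IsZnSet n A})) ∧
    GdeltaGenerated (sigmaGenerated {A | IsZomegaSet A}) := by
  refine ⟨fun n => ?_, ?_⟩
  · convert gdeltaGenerated_sigmaGenerated_isZnSet {n} using 3
    ext A
    simpa using fun h : IsZnSet n A => h.1
  · convert gdeltaGenerated_sigmaGenerated_isZnSet Set.univ using 3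
    ext A
    simp [IsZomegaSet]
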